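/- Let ω_0, ..., ω_ℓ be real numbers and M = max_i ω_i. The sequence of polynomials 1, (y−ω_0), (y−ω_0)(y−ω_1), ..., (y−ω_0)···(y−ω_ℓ) satisfies Descartes' rule of signs on (M, ∞): for any real coefficients c_0, ..., c_{ℓ+1}, the number of zeros of c_0 + c_1(y−ω_0) + ... + c_{ℓ+1}(y−ω_0)···(y−ω_ℓ) in (M, ∞), counted with multiplicity, is at most the number of sign changes in the sequence c_0, ..., c_{ℓ+1}. -/

import Mathlib

open Polynomial

/-- The number of sign changes in a finite sequence of reals: pairs i < j with
c i * c j < 0 and all intermediate entries zero. -/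
noncomputable def signChanges {m : ℕ} (c : Fin m → ℝ) : ℕ :=
  (Finset.univ.filter (fun p : Fin m × Fin m =>
    p.1 < p.2 ∧ c p.1 * c p.2 < 0 ∧ ∀ q : Fin m, p.1 < q → q < p.2 → c q = 0)).card

def AltAt (c : ℕ → ℝ) : ℕ → ℕ → Prop
  | 0, n => c n ≠ 0
  | (k + 1), n => ∃ m, m < n ∧ AltAt c k m ∧ c m * c n < 0

noncomputable def NB (w : ℕ → ℝ) (j : ℕ) : ℝ[X] := ∏ i ∈ Finset.range j, (X - C (w i))

lemma exists_term (c T : ℕ → ℝ) (hT : ∀ i, 0 < T i) (m n : ℕ) (hmn : m ≤ n) (x : ℝ)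
    (h : 0 < (∑ i ∈ Finset.range n, c i * T i - ∑ i ∈ Finset.range m, c i * T i) * x) :
    ∃ i, m ≤ i ∧ i < n ∧ 0 < c i * x := by
  rw [← Finset.sum_Ico_eq_sub _ hmn, Finset.sum_mul] at h
  obtain ⟨i, hi, hpos⟩ := Finset.exists_lt_of_sum_lt
    (s := Finset.Ico m n) (f := fun _ => (0 : ℝ)) (g := fun i => c i * T i * x) (by simpa using h)
  rw [Finset.mem_Ico] at hi
  refine ⟨i, hi.1, hi.2, ?_⟩
  have h2 : 0 < (c i * x) * T i := by nlinarith
  exact pos_of_mul_pos_left h2 (hT i).le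

lemma mul_neg_trans {a b x y : ℝ} (h1 : a * x < 0) (h2 : 0 < b * y) (h3 : 0 < x * y) :
    a * b < 0 := by
  by_contra h
  push Not at h
  have e1 : a * x * (b * y) < 0 := mul_neg_of_neg_of_pos h1 h2
  have e2 : 0 ≤ (a * b) * (x * y) := mul_nonneg h h3.le
  nlinarith

lemma alt_step (c T b : ℕ → ℝ) (hT : ∀ i, 0 < T i)
    (hb : ∀ j, b j * T (j + 1) = -∑ i ∈ Finset.range (j + 1), c i * T i) (k : ℕ) :
    ∀ n, AltAt b k n → ∃ m, m ≤ n ∧ AltAt c k m ∧ c m * b n < 0 := by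
  induction k with
  | zero =>
    intro n hn
    have hn : b n ≠ 0 := hn
    have hTn := hT (n + 1)
    obtain ⟨i, -, hi, hp⟩ := exists_term c T hT 0 (n + 1) (Nat.zero_le _) (-b n) (by
      have := hb n
      have e : ∑ i ∈ Finset.range (n + 1), c i * T i = - (b n * T (n + 1)) := by linarith
      rw [e]
      have : 0 < b n ^ 2 := by positivity
      simp only [Finset.range_zero, Finset.sum_empty]
      have := mul_pos this hTn
      nlinarith)
    refine ⟨i, by omega, ?_, by linarith⟩
    show c i ≠ 0
    rintro h
    simp [h] at hp
  | succ k ih =>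
    rintro n ⟨m, hmn, hm, hneg⟩
    obtain ⟨p, hpm, hp, hpneg⟩ := ih m hm
    obtain ⟨q, hq1, hq2, hq⟩ := exists_term c T hT (m + 1) (n + 1) (by omega) (-b n) (by
      have e : ∑ i ∈ Finset.range (n + 1), c i * T i = - (b n * T (n + 1)) := by
        linarith [hb n]
      have e' : ∑ i ∈ Finset.range (m + 1), c i * T i = - (b m * T (m + 1)) := by
        linarith [hb m]
      rw [e, e']
      have h1 : 0 ≤ b n ^ 2 * T (n + 1) := mul_nonneg (sq_nonneg _) (hT _).le
      have h2 : b m * b n * T (m + 1) < 0 := mul_neg_of_neg_of_pos hneg (hT _)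
      nlinarith)
    refine ⟨q, by omega, ⟨p, by omega, hp, ?_⟩, by linarith⟩
    exact mul_neg_trans hpneg hq (by linarith)

lemma alt_last (c T b : ℕ → ℝ) (hT : ∀ i, 0 < T i)
    (hb : ∀ j, b j * T (j + 1) = -∑ i ∈ Finset.range (j + 1), c i * T i) (N : ℕ)
    (hN : ∀ n, N ≤ n → ∑ i ∈ Finset.range n, c i * T i = 0) (k n : ℕ) (h : AltAt b k n) :
    ∃ m, AltAt c (k + 1) m := by
  obtain ⟨m, hmn, hm, hneg⟩ := alt_step c T b hT hb k n h
  have hbn : b n ≠ 0 := by rintro h; simp [h] at hneg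
  obtain ⟨q, hq1, hq2, hq⟩ := exists_term c T hT (n + 1) (N + n + 1) (by omega) (b n) (by
      have e : ∑ i ∈ Finset.range (n + 1), c i * T i = - (b n * T (n + 1)) := by
        linarith [hb n]
      rw [e, hN _ (by omega)]
      have : 0 < b n ^ 2 := by positivity
      have := mul_pos this (hT (n + 1))
      nlinarith)
  refine ⟨q, m, by omega, hm, mul_neg_trans hneg hq (mul_self_pos.mpr hbn)⟩

lemma NB_succ (w : ℕ → ℝ) (j : ℕ) : NB w (j + 1) = NB w j * (X - C (w j)) := by
  simp [NB, Finset.prod_range_succ]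

lemma div_id (w c b : ℕ → ℝ) (r : ℝ) (h0 : c 0 = -((r - w 0) * b 0))
    (h : ∀ j, c (j + 1) = b j - (r - w (j + 1)) * b (j + 1)) (n : ℕ) :
    (X - C r) * ∑ j ∈ Finset.range (n + 1), C (b j) * NB w j =
      ∑ j ∈ Finset.range (n + 1), C (c j) * NB w j + C (b n) * NB w (n + 1) := by
  induction n with
  | zero => simp [NB, h0]; ring
  | succ n ih =>
    rw [Finset.sum_range_succ, mul_add, ih, Finset.sum_range_succ _ (n + 1), h n,
      NB_succ w (n + 1)]
    simp only [C_sub, C_mul]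
    ring

lemma main_alt (w : ℕ → ℝ) (M : ℝ) (hw : ∀ i, w i ≤ M) (N : ℕ) (k : ℕ) :
    ∀ c : ℕ → ℝ, (∀ j, N ≤ j → c j = 0) →
      (∑ j ∈ Finset.range (N + 1), C (c j) * NB w j) ≠ 0 →
      k ≤ ((∑ j ∈ Finset.range (N + 1), C (c j) * NB w j).roots.filter (fun y => M < y)).card →
      ∃ n, AltAt c k n := by
  induction k with
  | zero =>
    intro c _ hne _
    by_contra hcon
    push Not at hcon
    apply hne
    refine Finset.sum_eq_zero fun j _ => ?_
    have : c j = 0 := by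
      by_contra h
      exact hcon j h
    simp [this]
  | succ k ih =>
    intro c hc hne hk
    set P := ∑ j ∈ Finset.range (N + 1), C (c j) * NB w j with hPdef
    obtain ⟨r, hr⟩ := Multiset.card_pos_iff_exists_mem.mp (lt_of_lt_of_le (Nat.succ_pos k) hk)
    rw [Multiset.mem_filter, mem_roots hne] at hr
    obtain ⟨hroot, hMr⟩ := hr
    let T : ℕ → ℝ := fun j => (NB w j).eval r
    have hTs : ∀ j, T (j + 1) = T j * (r - w j) := by
      intro j; simp [T, NB_succ]
    have ht : ∀ j, 0 < r - w j := fun j => by linarith [hw j]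
    have hT : ∀ j, 0 < T j := by
      intro j
      induction j with
      | zero => simp [T, NB]
      | succ j ihj => rw [hTs]; exact mul_pos ihj (ht j)
    let b : ℕ → ℝ := fun j => -(∑ i ∈ Finset.range (j + 1), c i * T i) / T (j + 1)
    have hb : ∀ j, b j * T (j + 1) = -∑ i ∈ Finset.range (j + 1), c i * T i := fun j =>
      div_mul_cancel₀ _ (hT _).ne'
    have hS : ∑ i ∈ Finset.range (N + 1), c i * T i = 0 := by
      have : P.eval r = 0 := hroot
      rw [hPdef, eval_finsetSum] at this
      simpa [T] using this
    have hN : ∀ n, N ≤ n → ∑ i ∈ Finset.range n, c i * T i = 0 := by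
      intro n hn
      have hS' : ∑ i ∈ Finset.range N, c i * T i = 0 := by
        rw [Finset.sum_range_succ, hc N le_rfl] at hS
        simpa using hS
      rw [← hS']
      symm
      apply Finset.sum_subset (Finset.range_mono hn)
      intro i _ hi
      rw [Finset.mem_range, not_lt] at hi
      simp [hc i hi]
    have hbz : ∀ j, N ≤ j → b j = 0 := by
      intro j hj
      simp only [b]
      rw [hN _ (by omega)]
      simp
    have hfac := div_id w c b r (by
        have h1 := hb 0
        simp only [zero_add, Finset.sum_range_one] at h1
        have h2 := hTs 0
        have h3 : T 0 = 1 := by simp [T, NB]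
        simp only [zero_add] at h2
        rw [h2, h3] at h1
        linarith) (by
        intro j
        have h1 := hb (j + 1)
        have h2 := hb j
        rw [Finset.sum_range_succ, hTs (j + 1)] at h1
        have h3 := hT (j + 1)
        apply mul_right_cancel₀ h3.ne'
        linarith) N
    rw [hbz N le_rfl, C_0, zero_mul, add_zero, ← hPdef] at hfac
    set Q := ∑ j ∈ Finset.range (N + 1), C (b j) * NB w j with hQ
    have hQ0 : Q ≠ 0 := by
      intro h; rw [h, mul_zero] at hfac; exact hne hfac.symm
    have hroots : P.roots = r ::ₘ Q.roots := by
      rw [← hfac, roots_mul (by rw [hfac]; exact hne), roots_X_sub_C, Multiset.singleton_add]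
    rw [hroots, Multiset.filter_cons_of_pos _ hMr, Multiset.card_cons] at hk
    obtain ⟨n, hn⟩ := ih b hbz hQ0 (Nat.le_of_succ_le_succ hk)
    exact alt_last c T b hT hb N hN k n hn

lemma exists_pair (c : ℕ → ℝ) (m n : ℕ) (hmn : m < n) (h : c m * c n < 0) :
    ∃ p q, m ≤ p ∧ p < q ∧ q ≤ n ∧ c p * c q < 0 ∧ ∀ i, p < i → i < q → c i = 0 := by
  induction hd : n - m using Nat.strong_induction_on generalizing m n with
  | _ d ih =>
    by_cases hall : ∀ i, m < i → i < n → c i = 0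
    · exact ⟨m, n, le_rfl, hmn, le_rfl, h, hall⟩
    · push Not at hall
      obtain ⟨i, h1, h2, h3⟩ := hall
      by_cases hs : c m * c i < 0
      · obtain ⟨p, q, a1, a2, a3, a4, a5⟩ := ih (i - m) (by omega) m i h1 hs rfl
        exact ⟨p, q, a1, a2, by omega, a4, a5⟩
      · have hm0 : c m ≠ 0 := by rintro h'; simp [h'] at h
        have hpos : 0 < c m * c i := lt_of_le_of_ne (not_lt.mp hs) (mul_ne_zero hm0 h3).symm
        have hin : c i * c n < 0 := by
          have := mul_neg_trans (a := c n) (b := c i) (x := c m) (y := c i) (by linarith)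
            (mul_self_pos.mpr h3) hpos
          linarith
        obtain ⟨p, q, a1, a2, a3, a4, a5⟩ := ih (n - i) (by omega) i n h2 hin rfl
        exact ⟨p, q, by omega, a2, a3, a4, a5⟩

lemma alt_le {L : ℕ} (c : Fin L → ℝ) (d : ℕ → ℝ) (hd : ∀ i : Fin L, d i = c i)
    (hd0 : ∀ j, L ≤ j → d j = 0) (k : ℕ) : ∀ n, AltAt d k n →
    k ≤ (Finset.univ.filter (fun p : Fin L × Fin L =>
      (p.1 < p.2 ∧ c p.1 * c p.2 < 0 ∧ ∀ q : Fin L, p.1 < q → q < p.2 → c q = 0) ∧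
        (p.2 : ℕ) ≤ n)).card := by
  induction k with
  | zero => intro n _; exact Nat.zero_le _
  | succ k ih =>
    rintro n ⟨m, hmn, hm, hneg⟩
    refine Nat.succ_le_of_lt (lt_of_le_of_lt (ih m hm) (Finset.card_lt_card ?_))
    obtain ⟨p, q, a1, a2, a3, a4, a5⟩ := exists_pair d m n hmn hneg
    have hq : q < L := by
      by_contra hq
      rw [hd0 q (by omega)] at a4
      simp at a4
    have hp : p < L := by omega
    rw [Finset.ssubset_iff_of_subset]
    · refine ⟨(⟨p, hp⟩, ⟨q, hq⟩), ?_, ?_⟩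
      · simp only [Finset.mem_filter, Finset.mem_univ, true_and]
        refine ⟨⟨a2, ?_, ?_⟩, a3⟩
        · rw [← hd, ← hd]; exact a4
        · intro i hi1 hi2
          rw [← hd]
          exact a5 i hi1 hi2
      · simp only [Finset.mem_filter, Finset.mem_univ, true_and, not_and]
        intro _
        omega
    · intro x hx
      simp only [Finset.mem_filter, Finset.mem_univ, true_and] at hx ⊢
      exact ⟨hx.1, by omega⟩

theorem stmt14 (l : ℕ) (ω : Fin (l + 1) → ℝ) (c : Fin (l + 2) → ℝ)
    (M : ℝ) (hM : M = Finset.univ.sup' Finset.univ_nonempty ω)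
    (P : ℝ[X])
    (hP : P = ∑ j : Fin (l + 2), C (c j) *
      ∏ i ∈ Finset.univ.filter (fun i : Fin (l + 1) => (i : ℕ) < (j : ℕ)),
        (X - C (ω i))) :
    (P.roots.filter (fun y => M < y)).card ≤ signChanges c := by
  by_cases hP0 : P = 0
  · simp [hP0]
  let w : ℕ → ℝ := fun i => if h : i < l + 1 then ω ⟨i, h⟩ else M
  let d : ℕ → ℝ := fun i => if h : i < l + 2 then c ⟨i, h⟩ else 0
  have hw : ∀ i, w i ≤ M := by
    intro i
    simp only [w]
    split_ifs with h
    · rw [hM]; exact Finset.le_sup' ω (Finset.mem_univ _)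
    · exact le_rfl
  have hd : ∀ i : Fin (l + 2), d i = c i := by
    intro i; simp [d]
  have hd0 : ∀ j, l + 2 ≤ j → d j = 0 := by
    intro j hj; simp [d, Nat.not_lt.mpr hj]
  have hPN : P = ∑ j ∈ Finset.range (l + 2 + 1), C (d j) * NB w j := by
    rw [Finset.sum_range_succ, hd0 (l + 2) le_rfl, C_0, zero_mul, add_zero,
      Finset.sum_range, hP]
    refine Finset.sum_congr rfl fun j _ => ?_
    rw [hd]
    congr 1
    unfold NB
    symm
    refine Finset.prod_bij' (fun i hi => (⟨i, by
        have := Finset.mem_range.mp hi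
        have := j.2
        omega⟩ : Fin (l + 1))) (fun i _ => (i : ℕ)) ?_ ?_ ?_ ?_ ?_
    · intro i hi; simpa using hi
    · intro i hi; simpa using hi
    · intro i hi; rfl
    · intro i hi; rfl
    · intro i hi
      have h1 := Finset.mem_range.mp hi
      have h2 := j.2
      have h3 : i < l + 1 := by omega
      simp only [w, dif_pos h3]
  obtain ⟨n, hn⟩ := main_alt w M hw (l + 2) _ d hd0 (by rw [← hPN]; exact hP0) le_rfl
  rw [← hPN] at hn
  refine (alt_le c d hd hd0 _ n hn).trans ?_
  unfold signChanges
  apply Finset.card_le_card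
  intro x hx
  simp only [Finset.mem_filter, Finset.mem_univ, true_and] at hx ⊢
  exact hx.1
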